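/- (Weighted sup-norm bound uniform in the period.) Fix 0 < ℓ < ℓ' < 1 and A > 0. There exists a constant C, depending only on ℓ, ℓ', A, κ₀, C_κ, C_H, and q (and in particular independent of L), such that the following holds for every L ≥ 1: if u is a classical L-periodic solution of the unforced conservation law ∂_t u = ∂_x(κ(u)∂_x u − H(u)) on [0,1] with ‖u(0,·)‖_{C_{p_ℓ}} ≤ A, then sup_{t∈[0,1]} ‖u(t,·)‖_{C_{p_{ℓ'}}} ≤ C. -/

import Mathlib

open Real Set

noncomputable section

/-- Partial derivative in time. -/
def pdT (u : ℝ → ℝ → ℝ) (t x : ℝ) : ℝ := deriv (fun s => u s x) t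

/-- Partial derivative in space. -/
def pdX (u : ℝ → ℝ → ℝ) (t x : ℝ) : ℝ := deriv (fun y => u t y) x

/-- The Japanese bracket `⟨x⟩ = √(4 + x²)`. -/
def jbr (x : ℝ) : ℝ := Real.sqrt (4 + x ^ 2)

/-- The weighted sup-norm `‖f‖_{C_{p_ℓ}} = sup_x |f x| / ⟨x⟩^ℓ`. -/
def wnorm (ℓ : ℝ) (f : ℝ → ℝ) : ℝ := ⨆ x : ℝ, |f x| / jbr x ^ ℓ

/-- A classical `L`-periodic solution of `∂ₜ u = ∂ₓ(κ(u) ∂ₓ u − H(u))` on `[0,T]`: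
continuous on `[0,T] × ℝ`, `L`-periodic, `C¹` in `t` and `C²` in `x` on `(0,T] × ℝ`,
satisfying the PDE pointwise there. -/
structure IsClassicalPeriodicSol (κ H : ℝ → ℝ) (L T : ℝ) (u : ℝ → ℝ → ℝ) : Prop where
  cont : ContinuousOn (fun p : ℝ × ℝ => u p.1 p.2) (Icc 0 T ×ˢ (univ : Set ℝ))
  periodic : ∀ t ∈ Icc 0 T, ∀ x, u t (x + L) = u t x
  reg_t : ∀ x, ContDiffOn ℝ 1 (fun s => u s x) (Ioc 0 T)
  reg_x : ∀ t ∈ Ioc 0 T, ContDiff ℝ 2 (fun y => u t y)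
  pde : ∀ t ∈ Ioc 0 T, ∀ x,
    pdT u t x = deriv (fun y => κ (u t y) * pdX u t y - H (u t y)) x

/-- Second derivative test (necessary condition) at a local maximum. -/
theorem IsLocalMax.deriv_deriv_nonpos {f : ℝ → ℝ} {x : ℝ} (h : IsLocalMax f x)
    (hf : ContinuousAt f x) : deriv (deriv f) x ≤ 0 := by
  by_contra! hpos
  have hmin := isLocalMin_of_deriv_deriv_pos hpos h.deriv_eq_zero hf
  have hconst : f =ᶠ[nhds x] fun _ => f x := by
    filter_upwards [h, hmin] with y h1 h2 using le_antisymm h1 h2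
  have := hconst.deriv.deriv_eq
  simp [this] at hpos

/-- A function that is maximal at the right end of an interval has nonnegative derivative there. -/
theorem HasDerivAt.nonneg_of_le_left {f : ℝ → ℝ} {f' s t : ℝ} (hf : HasDerivAt f f' t)
    (hst : s < t) (h : ∀ r ∈ Ico s t, f r ≤ f t) : 0 ≤ f' := by
  have htend : Filter.Tendsto (slope f t) (nhdsWithin t (Iio t)) (nhds f') :=
    (hasDerivWithinAt_iff_tendsto_slope' (by simp)).1 (hf.hasDerivWithinAt (s := Iio t))
  refine ge_of_tendsto htend ?_
  filter_upwards [Ico_mem_nhdsLT hst] with r hr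
  rw [slope_def_field]
  exact div_nonneg_of_nonpos (by linarith [h r hr]) (by linarith [hr.2])

/-- If a function on `[0,T] × ℝ` is negative initially and outside a bounded interval but not
everywhere, then there is a first time at which its supremum vanishes. -/
theorem exists_first_zero {g : ℝ → ℝ → ℝ} {T M : ℝ}
    (hc : ContinuousOn (fun p : ℝ × ℝ => g p.1 p.2) (Icc 0 T ×ˢ (univ : Set ℝ)))
    (h0 : ∀ x, g 0 x < 0) (hM : ∀ t ∈ Icc 0 T, ∀ x, x ∉ Icc (-M) M → g t x < 0)
    {t₀ x₀ : ℝ} (ht₀ : t₀ ∈ Icc 0 T) (hx₀ : 0 ≤ g t₀ x₀) :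
    ∃ t ∈ Ioc 0 t₀, ∃ x, g t x = 0 ∧ (∀ y, g t y ≤ 0) ∧ ∀ s ∈ Ico 0 t, g s x < 0 := by
  set K : Set (ℝ × ℝ) := (Icc 0 T ×ˢ Icc (-M) M) ∩ {p | 0 ≤ g p.1 p.2} with hK
  have hKc : IsCompact K := by
    have hcomp : IsCompact (Icc 0 T ×ˢ Icc (-M) M) := isCompact_Icc.prod isCompact_Icc
    refine hcomp.of_isClosed_subset ?_ inter_subset_left
    exact (hc.mono (prod_mono_right (subset_univ _))).preimage_isClosed_of_isClosed
      hcomp.isClosed isClosed_Ici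
  have hmem : ∀ t ∈ Icc 0 T, ∀ x, 0 ≤ g t x → (t, x) ∈ K := by
    intro t ht x hx
    refine ⟨⟨ht, ?_⟩, hx⟩
    by_contra hxM
    exact absurd (hM t ht x hxM) (not_lt.2 hx)
  obtain ⟨⟨t, x⟩, htx, hmin⟩ :=
    hKc.exists_isMinOn ⟨_, hmem t₀ ht₀ x₀ hx₀⟩ continuous_fst.continuousOn
  have htT : t ∈ Icc 0 T := htx.1.1
  have hgx : 0 ≤ g t x := htx.2
  have htpos : 0 < t := by
    rcases htT.1.lt_or_eq with h | h
    · exact h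
    · subst h
      exact absurd (h0 x) (not_lt.2 hgx)
  have hbefore : ∀ s ∈ Ico 0 t, ∀ y, g s y < 0 := by
    intro s hs y
    by_contra! hy
    have := hmin (hmem s ⟨hs.1, hs.2.le.trans htT.2⟩ y hy)
    exact absurd hs.2 (not_lt.2 this)
  have hle : ∀ y, g t y ≤ 0 := by
    intro y
    have hcy : ContinuousOn (fun s => g s y) (Icc 0 T) :=
      hc.comp (f := fun s => (s, y)) (by fun_prop) fun s hs => ⟨hs, mem_univ _⟩
    have hwithin : ContinuousWithinAt (fun s => g s y) (Ico 0 t) t :=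
      (hcy t htT).mono fun s hs => ⟨hs.1, hs.2.le.trans htT.2⟩
    refine hwithin.closure_le ?_ continuousWithinAt_const fun s hs => (hbefore s hs y).le
    rw [closure_Ico htpos.ne]
    exact ⟨htpos.le, le_rfl⟩
  exact ⟨t, ⟨htpos, hmin (hmem t₀ ht₀ x₀ hx₀)⟩, x, le_antisymm (hle x) hgx, hle,
    fun s hs => hbefore s hs x⟩

/-- The spatial profile of the barrier. -/
def barrier (ℓ R x : ℝ) : ℝ := (R ^ 2 + x ^ 2) ^ (ℓ / 2)

theorem barrier_pos (ℓ : ℝ) {R : ℝ} (hR : 0 < R) (x : ℝ) : 0 < barrier ℓ R x :=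
  Real.rpow_pos_of_pos (by positivity) _

theorem contDiff_barrier (ℓ : ℝ) {R : ℝ} (hR : 0 < R) : ContDiff ℝ 2 (barrier ℓ R) := by
  unfold barrier
  exact ContDiff.rpow_const_of_ne (by fun_prop) fun x => by positivity

theorem hasDerivAt_barrier (ℓ : ℝ) {R : ℝ} (hR : 0 < R) (x : ℝ) :
    HasDerivAt (barrier ℓ R) (ℓ * x * (R ^ 2 + x ^ 2) ^ (ℓ / 2 - 1)) x := by
  have h1 : HasDerivAt (fun y : ℝ => R ^ 2 + y ^ 2) (2 * x) x := by
    simpa using (hasDerivAt_pow 2 x).const_add (R ^ 2)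
  refine (h1.rpow_const (p := ℓ / 2) (Or.inl (by positivity))).congr_deriv ?_
  ring

theorem sq_deriv_barrier_le {ℓ R : ℝ} (hℓ : 0 < ℓ) (hℓ1 : ℓ < 1) (hR : 0 < R) (x : ℝ) :
    (deriv (barrier ℓ R) x) ^ 2 ≤ barrier ℓ R x ^ 2 / (R ^ 2 + x ^ 2) := by
  have hρ : 0 < R ^ 2 + x ^ 2 := by positivity
  have hw := barrier_pos ℓ hR x
  rw [(hasDerivAt_barrier ℓ hR x).deriv, Real.rpow_sub_one hρ.ne', ← barrier, le_div_iff₀ hρ]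
  have h : (ℓ * x * (barrier ℓ R x / (R ^ 2 + x ^ 2))) ^ 2 * (R ^ 2 + x ^ 2)
      = (ℓ ^ 2 * x ^ 2 / (R ^ 2 + x ^ 2)) * barrier ℓ R x ^ 2 := by
    field_simp
  rw [h]
  refine mul_le_of_le_one_left (by positivity) ((div_le_one hρ).2 ?_)
  have hx : ℓ ^ 2 * x ^ 2 ≤ x ^ 2 :=
    mul_le_of_le_one_left (sq_nonneg x) (pow_le_one₀ hℓ.le hℓ1.le)
  linarith [sq_nonneg R]

theorem deriv_deriv_barrier_le {ℓ R : ℝ} (hℓ : 0 < ℓ) (hℓ1 : ℓ < 1) (hR : 0 < R) (x : ℝ) :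
    deriv (deriv (barrier ℓ R)) x ≤ barrier ℓ R x / (R ^ 2 + x ^ 2) := by
  have hρ : 0 < R ^ 2 + x ^ 2 := by positivity
  have hw := barrier_pos ℓ hR x
  have h1 : HasDerivAt (fun y : ℝ => R ^ 2 + y ^ 2) (2 * x) x := by
    simpa using (hasDerivAt_pow 2 x).const_add (R ^ 2)
  have h2 := h1.rpow_const (p := ℓ / 2 - 1) (Or.inl hρ.ne')
  have h3 : HasDerivAt (fun y : ℝ => ℓ * y) ℓ x := by
    simpa using (hasDerivAt_id x).const_mul ℓ
  have hd : deriv (barrier ℓ R) = fun y => ℓ * y * (R ^ 2 + y ^ 2) ^ (ℓ / 2 - 1) :=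
    funext fun y => (hasDerivAt_barrier ℓ hR y).deriv
  rw [hd, (h3.fun_mul h2).deriv, barrier, ← Real.rpow_sub_one hρ.ne']
  have e1 : 0 ≤ (R ^ 2 + x ^ 2) ^ (ℓ / 2 - 1) := by positivity
  have e2 : 0 ≤ (R ^ 2 + x ^ 2) ^ (ℓ / 2 - 1 - 1) := by positivity
  have e3 : 0 ≤ x ^ 2 * (R ^ 2 + x ^ 2) ^ (ℓ / 2 - 1 - 1) := by positivity
  nlinarith [mul_nonneg (mul_nonneg hℓ.le (by linarith : 0 ≤ 2 - ℓ)) e3,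
    mul_nonneg (by linarith : 0 ≤ 1 - ℓ) e1]

theorem sq_barrier_div_le {ℓ R : ℝ} (hℓ1 : ℓ < 1) (hR : 0 < R) (x : ℝ) :
    barrier ℓ R x ^ 2 / (R ^ 2 + x ^ 2) ≤ (R ^ (ℓ - 1)) ^ 2 := by
  have hρ : 0 < R ^ 2 + x ^ 2 := by positivity
  have e1 : barrier ℓ R x ^ 2 / (R ^ 2 + x ^ 2) = (R ^ 2 + x ^ 2) ^ (ℓ - 1) := by
    rw [Real.rpow_sub_one hρ.ne', barrier, ← Real.rpow_natCast, ← Real.rpow_mul hρ.le]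
    norm_num
  have e2 : (R ^ (ℓ - 1)) ^ 2 = (R ^ 2) ^ (ℓ - 1) := by
    rw [← Real.rpow_natCast, ← Real.rpow_natCast, ← Real.rpow_mul hR.le, ← Real.rpow_mul hR.le]
    ring_nf
  rw [e1, e2]
  exact Real.rpow_le_rpow_of_nonpos (by positivity) (by nlinarith [sq_nonneg x]) (by linarith)

theorem one_le_barrier {ℓ R : ℝ} (hℓ : 0 < ℓ) (hR : 1 ≤ R) (x : ℝ) : 1 ≤ barrier ℓ R x :=
  Real.one_le_rpow (by nlinarith [sq_nonneg x]) (by linarith)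

theorem abs_rpow_le_barrier {ℓ R : ℝ} (hℓ : 0 < ℓ) (x : ℝ) : |x| ^ ℓ ≤ barrier ℓ R x := by
  have : |x| ^ ℓ = (x ^ 2) ^ (ℓ / 2) := by
    rw [← sq_abs, ← Real.rpow_natCast, ← Real.rpow_mul (abs_nonneg x)]
    congr 1
    push_cast
    ring
  rw [this]
  exact Real.rpow_le_rpow (sq_nonneg x) (by nlinarith [sq_nonneg R]) (by linarith)

/-- The algebraic inequality making the barrier a strict supersolution at a touching point:
`P = φ`, `D = φₓ`, `S ≥ uₓₓ`, and `r = 1 / (R² + x²)`. -/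
theorem supersolution_ineq {K a b P D S r δ k c h : ℝ}
    (hK : 0 ≤ K) (ha : 0 ≤ a) (hb : 0 ≤ b) (hP : 1 ≤ P) (hδ : 0 ≤ δ) (hr : 0 ≤ r)
    (hD : D ^ 2 ≤ P ^ 2 * r) (hPr : P ^ 2 * r ≤ δ ^ 2) (hS : S ≤ P * r)
    (hk0 : 0 ≤ k) (hkK : k ≤ K) (hc : |c| ≤ a * (1 + P)) (hh : |h| ≤ b * (1 + P))
    (hsmall : K * δ ^ 2 + 2 * a * δ ^ 2 + 2 * b * δ < 1) :
    k * S + c * D ^ 2 - h * D < P := by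
  have hr' : r ≤ δ ^ 2 := by nlinarith [mul_nonneg (by nlinarith : 0 ≤ P ^ 2 - 1) hr]
  have hDδ : |D| ≤ δ := abs_le_of_sq_le_sq (hD.trans hPr) hδ
  have t1 : k * S ≤ P * (K * δ ^ 2) := by
    calc k * S ≤ k * (P * r) := by gcongr
      _ ≤ K * (P * δ ^ 2) := by gcongr
      _ = _ := by ring
  have t2 : c * D ^ 2 ≤ P * (2 * a * δ ^ 2) := by
    calc c * D ^ 2 ≤ (a * (1 + P)) * δ ^ 2 :=
          mul_le_mul ((le_abs_self c).trans hc) (hD.trans hPr) (sq_nonneg D) (by positivity)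
      _ ≤ (a * (P + P)) * δ ^ 2 := by gcongr
      _ = _ := by ring
  have t3 : -(h * D) ≤ P * (2 * b * δ) := by
    calc -(h * D) ≤ |h * D| := neg_le_abs _
      _ = |h| * |D| := abs_mul h D
      _ ≤ (b * (1 + P)) * δ := by gcongr
      _ ≤ (b * (P + P)) * δ := by gcongr
      _ = _ := by ring
  nlinarith [mul_pos (by linarith : 0 < P) (sub_pos.2 hsmall)]

/-- Comparison with the barrier `B eᵗ (R² + x²)^{ℓ/2}` for bounded solutions of quasilinear
parabolic equations in nondivergence form. -/
theorem lt_barrier_of_parabolic {v : ℝ → ℝ → ℝ} {ℓ B R K a b N : ℝ}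
    (hℓ : 0 < ℓ) (hℓ1 : ℓ < 1) (hB : 1 ≤ B) (hR : 1 ≤ R)
    (hK : 0 ≤ K) (ha : 0 ≤ a) (hb : 0 ≤ b)
    (hsmall : K * (B * exp 1 * R ^ (ℓ - 1)) ^ 2 + 2 * a * (B * exp 1 * R ^ (ℓ - 1)) ^ 2
      + 2 * b * (B * exp 1 * R ^ (ℓ - 1)) < 1)
    (hcont : ContinuousOn (fun p : ℝ × ℝ => v p.1 p.2) (Icc 0 1 ×ˢ (univ : Set ℝ)))
    (hN : ∀ t ∈ Icc (0 : ℝ) 1, ∀ x, v t x ≤ N)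
    (h0 : ∀ x, v 0 x < B * barrier ℓ R x)
    (hreg : ∀ t ∈ Ioo (0 : ℝ) 1, ContDiff ℝ 2 (v t))
    (hpde : ∀ t ∈ Ioo (0 : ℝ) 1, ∀ x, ∃ k c h, 0 ≤ k ∧ k ≤ K ∧
      |c| ≤ a * (1 + |v t x|) ∧ |h| ≤ b * (1 + |v t x|) ∧
      HasDerivAt (fun s => v s x)
        (k * deriv (deriv (v t)) x + c * (deriv (v t) x) ^ 2 - h * deriv (v t) x) t) :
    ∀ t ∈ Ico (0 : ℝ) 1, ∀ x, v t x < B * exp t * barrier ℓ R x := by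
  intro t₀ ht₀ x₀
  by_contra! hcontra
  have hR0 : 0 < R := by linarith
  have hbc := contDiff_barrier ℓ hR0
  have hbcont : Continuous (barrier ℓ R) := hbc.continuous
  set g : ℝ → ℝ → ℝ := fun t x => v t x - B * exp t * barrier ℓ R x with hg
  obtain ⟨M, hM⟩ : ∃ M : ℝ, ∀ x : ℝ, x ∉ Icc (-M) M → N < |x| ^ ℓ := by
    obtain ⟨M, hM⟩ := Filter.eventually_atTop.1
      ((tendsto_rpow_atTop hℓ).eventually_gt_atTop N)
    refine ⟨M, fun x hx => hM _ ?_⟩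
    by_contra! h
    exact hx (abs_le.1 h.le)
  obtain ⟨t, ht, x, hzero, hmax, hbefore⟩ := exists_first_zero (g := g) (T := 1) (M := M)
    (hcont.sub (by fun_prop)) (fun x => by simpa [hg] using h0 x)
    (fun t ht x hx => by
      have h1 := hN t ht x
      have h2 := hM x hx
      have h3 := abs_rpow_le_barrier (R := R) hℓ x
      have h4 : 1 ≤ exp t := one_le_exp ht.1
      have h5 := barrier_pos ℓ hR0 x
      have h6 : 1 ≤ B * exp t := by nlinarith
      have h7 : barrier ℓ R x ≤ B * exp t * barrier ℓ R x := le_mul_of_one_le_left h5.le h6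
      simp only [hg]
      linarith)
    ⟨ht₀.1, ht₀.2.le⟩ (sub_nonneg.2 hcontra)
  have ht1 : t < 1 := ht.2.trans_lt ht₀.2
  have htI : t ∈ Ioo (0 : ℝ) 1 := ⟨ht.1, ht1⟩
  have hv2 := hreg t htI
  obtain ⟨k, c, h, hk0, hkK, hc, hh, hder⟩ := hpde t htI x
  set E := B * exp t with hE
  have hE1 : 1 ≤ E := by
    have : 1 ≤ exp t := one_le_exp ht.1.le
    nlinarith
  have hEe : E ≤ B * exp 1 := by
    have := exp_le_exp.2 ht1.le
    rw [hE]
    gcongr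
  have hw := barrier_pos ℓ hR0 x
  have hlm : IsLocalMax (g t) x :=
    Filter.Eventually.of_forall fun y => by rw [hzero]; exact hmax y
  have hvd : Differentiable ℝ (v t) := hv2.differentiable (by norm_num)
  have hbd : Differentiable ℝ (barrier ℓ R) := hbc.differentiable (by norm_num)
  have hvd' : Differentiable ℝ (deriv (v t)) :=
    hv2.differentiable_deriv_two
  have hbd' : Differentiable ℝ (deriv (barrier ℓ R)) :=
    hbc.differentiable_deriv_two
  have hgd : deriv (g t) = fun y => deriv (v t) y - E * deriv (barrier ℓ R) y := by
    funext y
    exact ((hvd y).hasDerivAt.sub ((hbd y).hasDerivAt.const_mul E)).deriv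
  have hgdd : deriv (deriv (g t)) x
      = deriv (deriv (v t)) x - E * deriv (deriv (barrier ℓ R)) x := by
    rw [hgd]
    exact ((hvd' x).hasDerivAt.sub ((hbd' x).hasDerivAt.const_mul E)).deriv
  have hfirst : deriv (v t) x = E * deriv (barrier ℓ R) x := by
    have := hlm.deriv_eq_zero
    rw [hgd] at this
    linarith
  have hsecond : deriv (deriv (v t)) x ≤ E * deriv (deriv (barrier ℓ R)) x := by
    have := hlm.deriv_deriv_nonpos (hv2.continuous.sub (hbcont.const_mul E)).continuousAt
    rw [hgdd] at this
    linarith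
  have hval : v t x = E * barrier ℓ R x := by
    have := hzero
    simp only [hg] at this
    linarith
  have htime := (hder.sub (((Real.hasDerivAt_exp t).const_mul B).mul_const
    (barrier ℓ R x))).nonneg_of_le_left ht.1 fun s hs => by
      have h1 := hbefore s hs
      have h2 := hzero
      simp only [hg] at h1 h2
      simp only [Pi.sub_apply]
      linarith
  have hPpos : 1 ≤ E * barrier ℓ R x := by
    nlinarith [one_le_barrier hℓ hR x]
  rw [hval, abs_of_pos (by linarith : 0 < E * barrier ℓ R x)] at hc hh
  have hEsq : 0 ≤ E ^ 2 := sq_nonneg E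
  have key := supersolution_ineq (K := K) (a := a) (b := b) (P := E * barrier ℓ R x)
    (D := deriv (v t) x) (S := deriv (deriv (v t)) x) (r := (R ^ 2 + x ^ 2)⁻¹)
    (δ := B * exp 1 * R ^ (ℓ - 1)) (k := k) (c := c) (h := h)
    hK ha hb hPpos (by positivity) (by positivity)
    (by
      rw [hfirst, mul_pow E, mul_pow E, mul_assoc, ← div_eq_mul_inv]
      exact mul_le_mul_of_nonneg_left (sq_deriv_barrier_le hℓ hℓ1 hR0 x) hEsq)
    (by
      rw [mul_pow E, mul_assoc, ← div_eq_mul_inv, mul_pow (B * exp 1)]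
      exact mul_le_mul (pow_le_pow_left₀ (by linarith) hEe 2) (sq_barrier_div_le hℓ1 hR0 x)
        (by positivity) (by positivity))
    (by
      rw [mul_assoc, ← div_eq_mul_inv]
      exact hsecond.trans (mul_le_mul_of_nonneg_left (deriv_deriv_barrier_le hℓ hℓ1 hR0 x)
        (by linarith)))
    hk0 hkK hc hh hsmall
  linarith

theorem jbr_pos (x : ℝ) : 0 < jbr x := Real.sqrt_pos.2 (by positivity)

theorem one_le_jbr (x : ℝ) : 1 ≤ jbr x := Real.one_le_sqrt.2 (by nlinarith [sq_nonneg x])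

theorem jbr_rpow (ℓ x : ℝ) : jbr x ^ ℓ = barrier ℓ 2 x := by
  rw [jbr, barrier, Real.sqrt_eq_rpow, ← Real.rpow_mul (by positivity)]
  norm_num
  ring_nf

theorem barrier_le_jbr_rpow {ℓ R : ℝ} (hℓ : 0 < ℓ) (hR : 1 ≤ R) (x : ℝ) :
    barrier ℓ R x ≤ R ^ ℓ * jbr x ^ ℓ := by
  have : R ^ ℓ = (R ^ 2) ^ (ℓ / 2) := by
    rw [← Real.rpow_natCast, ← Real.rpow_mul (by linarith)]
    congr 1
    push_cast
    ring
  rw [jbr_rpow, barrier, barrier, this, ← Real.mul_rpow (by positivity) (by positivity)]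
  refine Real.rpow_le_rpow (by positivity) ?_ (by linarith)
  nlinarith [sq_nonneg x, mul_nonneg (by nlinarith : 0 ≤ R ^ 2 - 1) (sq_nonneg x)]

/-- Classical periodic solutions are bounded. -/
theorem IsClassicalPeriodicSol.exists_bound {κ H : ℝ → ℝ} {L T : ℝ} {u : ℝ → ℝ → ℝ}
    (hu : IsClassicalPeriodicSol κ H L T u) (hL : 0 < L) :
    ∃ N, ∀ t ∈ Icc 0 T, ∀ x, |u t x| ≤ N := by
  obtain ⟨N, hN⟩ := (isCompact_Icc.prod isCompact_Icc : IsCompact (Icc 0 T ×ˢ Icc 0 L))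
    |>.exists_bound_of_continuousOn (hu.cont.mono (prod_mono_right (subset_univ _)))
  refine ⟨N, fun t ht x => ?_⟩
  have hper : Function.Periodic (u t) L := hu.periodic t ht
  obtain ⟨y, hy, hxy⟩ := hper.exists_mem_Ico₀ hL x
  rw [hxy]
  exact hN (t, y) ⟨ht, Ico_subset_Icc_self hy⟩

/-- The equation in nondivergence form at interior times. -/
theorem IsClassicalPeriodicSol.hasDerivAt {κ H : ℝ → ℝ} {L T : ℝ} {u : ℝ → ℝ → ℝ}
    (hu : IsClassicalPeriodicSol κ H L T u) (hκ : ContDiff ℝ 1 κ) (hH : ContDiff ℝ 1 H)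
    {t : ℝ} (ht : t ∈ Ioo 0 T) (x : ℝ) :
    HasDerivAt (fun s => u s x) (κ (u t x) * deriv (deriv (u t)) x
      + deriv κ (u t x) * (deriv (u t) x) ^ 2 - deriv H (u t x) * deriv (u t) x) t := by
  have ht' : t ∈ Ioc 0 T := Ioo_subset_Ioc_self ht
  have hdt : DifferentiableAt ℝ (fun s => u s x) t :=
    ((hu.reg_t x).differentiableOn (by norm_num)).differentiableAt
      (Filter.mem_of_superset (Ioo_mem_nhds ht.1 ht.2) Ioo_subset_Ioc_self)
  have hux : ContDiff ℝ 2 (u t) := hu.reg_x t ht'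
  have h1 : HasDerivAt (u t) (deriv (u t) x) x :=
    (hux.differentiable (by norm_num) x).hasDerivAt
  have h2 : HasDerivAt (deriv (u t)) (deriv (deriv (u t)) x) x :=
    (hux.differentiable_deriv_two x).hasDerivAt
  have hk : HasDerivAt (fun y => κ (u t y)) (deriv κ (u t x) * deriv (u t) x) x :=
    (hκ.differentiable (by norm_num) (u t x)).hasDerivAt.comp x h1
  have hh : HasDerivAt (fun y => H (u t y)) (deriv H (u t x) * deriv (u t) x) x :=
    (hH.differentiable (by norm_num) (u t x)).hasDerivAt.comp x h1
  have hp : pdT u t x = _ := (hu.pde t ht' x).trans ((hk.mul h2).sub hh).deriv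
  refine hdt.hasDerivAt.congr_deriv ?_
  change pdT u t x = _
  rw [hp]
  ring

/-- The initial bound, unfolded pointwise. -/
theorem IsClassicalPeriodicSol.abs_initial_le {κ H : ℝ → ℝ} {L T ℓ A : ℝ} {u : ℝ → ℝ → ℝ}
    (hu : IsClassicalPeriodicSol κ H L T u) (hL : 0 < L) (hT : 0 ≤ T) (hℓ : 0 < ℓ)
    (hA : wnorm ℓ (u 0) ≤ A) (x : ℝ) : |u 0 x| ≤ A * jbr x ^ ℓ := by
  obtain ⟨N, hN⟩ := hu.exists_bound hL
  have hbdd : BddAbove (range fun x => |u 0 x| / jbr x ^ ℓ) := by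
    refine ⟨N, ?_⟩
    rintro _ ⟨y, rfl⟩
    exact (div_le_self (abs_nonneg _) (Real.one_le_rpow (one_le_jbr y) hℓ.le)).trans
      (hN 0 ⟨le_rfl, hT⟩ y)
  exact (div_le_iff₀ (Real.rpow_pos_of_pos (jbr_pos x) ℓ)).1 ((le_ciSup hbdd x).trans hA)

/-- Weighted sup-norm bound for the periodized problem, uniform in the period `L ≥ 1`:
if `‖u(0,·)‖_{C_{p_ℓ}} ≤ A`, then `sup_{t ∈ [0,1]} ‖u(t,·)‖_{C_{p_{ℓ'}}} ≤ C` with `C`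
depending only on `ℓ, ℓ', A, κ₀, C_κ, C_H, q`. -/
theorem weighted_sup_bound
    (ℓ ℓ' A κ₀ C_κ C_H q : ℝ)
    (hℓ : 0 < ℓ) (hℓℓ' : ℓ < ℓ') (hℓ' : ℓ' < 1) (hA : 0 < A)
    (hκ₀ : κ₀ ∈ Ioc (0:ℝ) 1) (hCκ : 0 < C_κ) (hCH : 0 < C_H) (hq : q ∈ Ioc (1:ℝ) 2) :
    ∃ C : ℝ, ∀ (L : ℝ), 1 ≤ L → ∀ (κ H : ℝ → ℝ),
      (∀ s : ℝ, κ₀ ≤ κ s ∧ κ s ≤ κ₀⁻¹) → ContDiff ℝ 1 κ →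
      (∀ s : ℝ, |deriv κ s| ≤ C_κ * (1 + |s|)) →
      ContDiff ℝ 1 H →
      (∀ s : ℝ, |deriv H s| ≤ C_H * (1 + |s|) ^ (q / 2)) →
      ∀ u : ℝ → ℝ → ℝ, IsClassicalPeriodicSol κ H L 1 u →
        wnorm ℓ (u 0) ≤ A →
        ∀ t ∈ Icc (0:ℝ) 1, wnorm ℓ' (u t) ≤ C := by
  have hℓ1 : ℓ < 1 := hℓℓ'.trans hℓ'
  have hκ₀pos : 0 < κ₀ := hκ₀.1
  obtain ⟨R, hR, hsmall⟩ : ∃ R : ℝ, 2 ≤ R ∧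
      κ₀⁻¹ * ((A + 1) * exp 1 * R ^ (ℓ - 1)) ^ 2
        + 2 * C_κ * ((A + 1) * exp 1 * R ^ (ℓ - 1)) ^ 2
        + 2 * C_H * ((A + 1) * exp 1 * R ^ (ℓ - 1)) < 1 := by
    have h1 : Filter.Tendsto (fun R : ℝ => R ^ (ℓ - 1)) Filter.atTop (nhds 0) := by
      simpa using tendsto_rpow_neg_atTop (y := 1 - ℓ) (by linarith)
    have h2 : Continuous fun z : ℝ => κ₀⁻¹ * ((A + 1) * exp 1 * z) ^ 2
        + 2 * C_κ * ((A + 1) * exp 1 * z) ^ 2 + 2 * C_H * ((A + 1) * exp 1 * z) := by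
      fun_prop
    have h3 := (h2.tendsto 0).comp h1
    have h4 := h3.eventually_lt_const (u := 1) (by simp)
    obtain ⟨R, hR1, hR2⟩ := (h4.and (Filter.eventually_ge_atTop 2)).exists
    exact ⟨R, hR2, hR1⟩
  have hR1 : 1 ≤ R := by linarith
  have hR0 : 0 < R := by linarith
  refine ⟨(A + 1) * exp 1 * R ^ ℓ, fun L hL κ H hκb hκ hκ' hH hH' u hu hu0 => ?_⟩
  have hLpos : 0 < L := by linarith
  obtain ⟨N, hN⟩ := hu.exists_bound hLpos
  have hH'' : ∀ s : ℝ, |deriv H s| ≤ C_H * (1 + |s|) := fun s =>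
    (hH' s).trans (mul_le_mul_of_nonneg_left (Real.rpow_le_self_of_one_le
      (by linarith [abs_nonneg s]) (by linarith [hq.2])) hCH.le)
  have hinit : ∀ x, |u 0 x| < (A + 1) * barrier ℓ R x := by
    intro x
    have h1 := hu.abs_initial_le hLpos zero_le_one hℓ hu0 x
    have h2 : jbr x ^ ℓ ≤ barrier ℓ R x := by
      rw [jbr_rpow]
      exact Real.rpow_le_rpow (by positivity) (by nlinarith) (by linarith)
    nlinarith [barrier_pos ℓ hR0 x]
  have hupper : ∀ t ∈ Ico (0 : ℝ) 1, ∀ x, u t x < (A + 1) * exp t * barrier ℓ R x :=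
    lt_barrier_of_parabolic hℓ hℓ1 (by linarith) hR1 (by positivity) hCκ.le hCH.le hsmall
      hu.cont (fun t ht x => (le_abs_self _).trans (hN t ht x))
      (fun x => (le_abs_self _).trans_lt (hinit x))
      (fun t ht => hu.reg_x t (Ioo_subset_Ioc_self ht))
      fun t ht x => ⟨κ (u t x), deriv κ (u t x), deriv H (u t x),
        hκ₀pos.le.trans (hκb _).1, (hκb _).2, hκ' _, hH'' _, hu.hasDerivAt hκ hH ht x⟩
  have hlower : ∀ t ∈ Ico (0 : ℝ) 1, ∀ x, -u t x < (A + 1) * exp t * barrier ℓ R x :=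
    lt_barrier_of_parabolic (v := fun t x => -u t x)
      hℓ hℓ1 (by linarith) hR1 (by positivity) hCκ.le hCH.le hsmall
      hu.cont.neg (fun t ht x => (neg_le_abs _).trans (hN t ht x))
      (fun x => (neg_le_abs _).trans_lt (hinit x))
      (fun t ht => (hu.reg_x t (Ioo_subset_Ioc_self ht)).neg)
      fun t ht x => ⟨κ (u t x), -deriv κ (u t x), deriv H (u t x),
        hκ₀pos.le.trans (hκb _).1, (hκb _).2, by simpa using hκ' _, by simpa using hH'' _, by
          have hd : deriv (fun y => -u t y) = fun y => -deriv (u t) y :=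
            funext fun y => deriv.fun_neg
          have hdd : deriv (deriv fun y => -u t y) x = -deriv (deriv (u t)) x := by
            rw [hd]
            exact deriv.fun_neg
          refine (hu.hasDerivAt hκ hH ht x).fun_neg.congr_deriv ?_
          rw [hdd, hd]
          ring⟩
  have hpoint : ∀ x, ∀ t ∈ Ico (0 : ℝ) 1,
      |u t x| ≤ (A + 1) * exp 1 * R ^ ℓ * jbr x ^ ℓ' := by
    intro x t ht
    have h1 : |u t x| ≤ (A + 1) * exp t * barrier ℓ R x :=
      abs_le'.2 ⟨(hupper t ht x).le, (hlower t ht x).le⟩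
    have h2 : barrier ℓ R x ≤ R ^ ℓ * jbr x ^ ℓ' :=
      (barrier_le_jbr_rpow hℓ hR1 x).trans (mul_le_mul_of_nonneg_left
        (Real.rpow_le_rpow_of_exponent_le (one_le_jbr x) hℓℓ'.le) (by positivity))
    calc |u t x| ≤ (A + 1) * exp t * barrier ℓ R x := h1
      _ ≤ (A + 1) * exp 1 * (R ^ ℓ * jbr x ^ ℓ') :=
        mul_le_mul (mul_le_mul_of_nonneg_left (exp_le_exp.2 ht.2.le) (by linarith)) h2
          (barrier_pos ℓ hR0 x).le (by positivity)
      _ = _ := by ring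
  intro t ht
  refine ciSup_le fun x => (div_le_iff₀ (Real.rpow_pos_of_pos (jbr_pos x) ℓ')).2 ?_
  have hcx : ContinuousOn (fun s => |u s x|) (Icc 0 1) :=
    (hu.cont.comp (f := fun s => (s, x)) (by fun_prop) fun s hs => ⟨hs, mem_univ _⟩).abs
  refine ContinuousWithinAt.closure_le (s := Ico (0 : ℝ) 1) ?_
    ((hcx t ht).mono Ico_subset_Icc_self) continuousWithinAt_const (hpoint x)
  rwa [closure_Ico zero_ne_one]
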